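/- Let (n, τ₁, τ₂) be an orthonormal basis of ℝ³ and let a, b, c, f ∈ ℝ³ be vectors satisfying the system Q a + R b + S c + T f = 0, where Q is the 3×3 matrix with rows nᵀ, τ₁ᵀ, τ₂ᵀ; R the matrix with rows τ₁ᵀ, nᵀ, 0; S the matrix with rows τ₂ᵀ, 0, nᵀ; and T the matrix with rows 0, τ₁ᵀ, τ₂ᵀ. Then a = −(⟨τ₁, b⟩ + ⟨τ₂, c⟩) n − (⟨n, b⟩ + ⟨τ₁, f⟩) τ₁ − (⟨n, c⟩ + ⟨τ₂, f⟩) τ₂. In particular, if b = c = 0 and ⟨f, τ₁⟩ = ⟨f, τ₂⟩ = 0 (the interface force has no tangential component), then a = 0. -/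

import Mathlib

open Matrix
open scoped RealInnerProductSpace

/-- The 3×3 real matrix whose rows are the (coordinates of the) three given vectors of `ℝ³`. -/
def rowMatrix (r₀ r₁ r₂ : EuclideanSpace ℝ (Fin 3)) : Matrix (Fin 3) (Fin 3) ℝ :=
  Matrix.of ![(fun j => r₀ j), (fun j => r₁ j), (fun j => r₂ j)]

/-- The entries of `rowMatrix r₀ r₁ r₂ *ᵥ v` are the inner products of the rows with `v`. -/
theorem rowMatrix_mulVec (r₀ r₁ r₂ v : EuclideanSpace ℝ (Fin 3)) :
    rowMatrix r₀ r₁ r₂ *ᵥ (fun j => v j) = ![⟪r₀, v⟫, ⟪r₁, v⟫, ⟪r₂, v⟫] := by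
  ext i
  fin_cases i <;>
    simp [rowMatrix, Matrix.mulVec, dotProduct, PiLp.inner_apply, mul_comm]

/-- Every vector of `ℝ³` is the sum of its components along an orthonormal triple. -/
theorem eq_sum_inner_smul_of_orthonormal {e₀ e₁ e₂ : EuclideanSpace ℝ (Fin 3)}
    (h : Orthonormal ℝ ![e₀, e₁, e₂]) (v : EuclideanSpace ℝ (Fin 3)) :
    v = ⟪e₀, v⟫ • e₀ + ⟪e₁, v⟫ • e₁ + ⟪e₂, v⟫ • e₂ := by
  have hspan : ⊤ ≤ Submodule.span ℝ (Set.range ![e₀, e₁, e₂]) :=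
    (h.linearIndependent.span_eq_top_of_card_eq_finrank (by simp)).ge
  simpa [Fin.sum_univ_three] using ((OrthonormalBasis.mk h hspan).sum_repr' v).symm

/-- Let `(n, τ₁, τ₂)` be an orthonormal basis of `ℝ³` and let `a, b, c, f ∈ ℝ³` satisfy
`Q a + R b + S c + T f = 0`, where `Q` has rows `nᵀ, τ₁ᵀ, τ₂ᵀ`; `R` has rows `τ₁ᵀ, nᵀ, 0`;
`S` has rows `τ₂ᵀ, 0, nᵀ`; and `T` has rows `0, τ₁ᵀ, τ₂ᵀ`. Then
`a = −(⟨τ₁,b⟩+⟨τ₂,c⟩) n − (⟨n,b⟩+⟨τ₁,f⟩) τ₁ − (⟨n,c⟩+⟨τ₂,f⟩) τ₂`; in particular, if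
`b = c = 0` and `f` has no tangential component then `a = 0`. -/
theorem jump_condition_system_solution
    (n τ₁ τ₂ : EuclideanSpace ℝ (Fin 3))
    (hON : Orthonormal ℝ ![n, τ₁, τ₂])
    (a b c f : EuclideanSpace ℝ (Fin 3))
    (hsys : rowMatrix n τ₁ τ₂ *ᵥ (fun j => a j)
          + rowMatrix τ₁ n 0 *ᵥ (fun j => b j)
          + rowMatrix τ₂ 0 n *ᵥ (fun j => c j)
          + rowMatrix 0 τ₁ τ₂ *ᵥ (fun j => f j) = 0) :
    a = -((⟪τ₁, b⟫ + ⟪τ₂, c⟫) • n) - (⟪n, b⟫ + ⟪τ₁, f⟫) • τ₁ - (⟪n, c⟫ + ⟪τ₂, f⟫) • τ₂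
    ∧ (b = 0 → c = 0 → ⟪f, τ₁⟫ = 0 → ⟪f, τ₂⟫ = 0 → a = 0) := by
  simp only [rowMatrix_mulVec] at hsys
  have h₀ := congrFun hsys 0
  have h₁ := congrFun hsys 1
  have h₂ := congrFun hsys 2
  simp at h₀ h₁ h₂
  have ha : a = -((⟪τ₁, b⟫ + ⟪τ₂, c⟫) • n) - (⟪n, b⟫ + ⟪τ₁, f⟫) • τ₁
      - (⟪n, c⟫ + ⟪τ₂, f⟫) • τ₂ := by
    have e₀ : ⟪n, a⟫ = -(⟪τ₁, b⟫ + ⟪τ₂, c⟫) := by linarith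
    have e₁ : ⟪τ₁, a⟫ = -(⟪n, b⟫ + ⟪τ₁, f⟫) := by linarith
    have e₂ : ⟪τ₂, a⟫ = -(⟪n, c⟫ + ⟪τ₂, f⟫) := by linarith
    rw [eq_sum_inner_smul_of_orthonormal hON a, e₀, e₁, e₂]
    module
  refine ⟨ha, fun hb hc hf₁ hf₂ => ?_⟩
  rw [real_inner_comm] at hf₁ hf₂
  simpa [hb, hc, hf₁, hf₂] using ha
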